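/- Let 1 < α < 2 and T > 0. Let (λ_n) be a sequence of positive reals, and let (a_n), (b_n) be real sequences with Σ_n λ_n a_n² < ∞ and Σ_n b_n² < ∞. Then there exists C > 0 such that for every t ∈ (0,T], Σ_{n=1}^∞ λ_n^{−1/α} · λ_n² · | a_n E_{α,1}(−λ_n t^α) + b_n t E_{α,2}(−λ_n t^α) |² ≤ C t^{1−α} Σ_n λ_n a_n² + C t^{3−2α} Σ_n b_n². (This is the spectral-coefficient form of the estimate ‖∂_t^α u(t,·)‖²_{D(A^{−1/(2α)})} ≤ C t^{1−α} ‖u₀‖²_{H¹₀(Ω)} + C t^{3−2α} ‖u₁‖²_{L²(Ω)}.) -/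

import Mathlib

open Complex Real

/-- The Mittag–Leffler function `E_{α,β}(z) = Σ_{k=0}^∞ z^k / Γ(αk + β)`. -/
noncomputable def mittagLeffler (α β : ℝ) (z : ℂ) : ℂ :=
  ∑' k : ℕ, z ^ k / Complex.Gamma ((α * k + β : ℝ) : ℂ)

section Auxiliary

open MeasureTheory Set Filter Topology

theorem integrableOn_rpow_mul_exp_neg_mul {q c : ℝ} (hq : -1 < q) (hc : 0 < c) :
    IntegrableOn (fun t : ℝ => t ^ q * Real.exp (-(c * t))) (Ioi 0) := by
  simpa using integrableOn_rpow_mul_exp_neg_mul_rpow (p := 1) hq one_pos hc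

theorem norm_rpow_mul_cexp_neg_mul {q t : ℝ} (ht : 0 < t) (s : ℂ) :
    ‖((t ^ q : ℝ) : ℂ) * Complex.exp (-(s * t))‖ = t ^ q * Real.exp (-(s.re * t)) := by
  rw [norm_mul, Complex.norm_exp, Complex.norm_of_nonneg (by positivity)]
  simp

theorem aestronglyMeasurable_rpow_mul_cexp (q : ℝ) (s : ℂ) (μ : Measure ℝ) :
    AEStronglyMeasurable (fun t : ℝ => ((t ^ q : ℝ) : ℂ) * Complex.exp (-(s * t))) μ := by
  have : Measurable fun t : ℝ => t ^ q := by fun_prop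
  exact (by fun_prop : Measurable
    (fun t : ℝ => ((t ^ q : ℝ) : ℂ) * Complex.exp (-(s * t)))).aestronglyMeasurable

theorem integrableOn_rpow_mul_cexp_neg_mul {q : ℝ} {s : ℂ} (hq : -1 < q) (hs : 0 < s.re) :
    IntegrableOn (fun t : ℝ => ((t ^ q : ℝ) : ℂ) * Complex.exp (-(s * t))) (Ioi 0) := by
  refine (integrableOn_rpow_mul_exp_neg_mul hq hs).mono'
    (aestronglyMeasurable_rpow_mul_cexp _ _ _) ?_
  filter_upwards [ae_restrict_mem measurableSet_Ioi] with t ht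
  exact (norm_rpow_mul_cexp_neg_mul ht s).le

theorem differentiableOn_integral_rpow_mul_cexp_neg_mul {q : ℝ} (hq : -1 < q) :
    DifferentiableOn ℂ
      (fun s : ℂ => ∫ t in Ioi (0 : ℝ), ((t ^ q : ℝ) : ℂ) * Complex.exp (-(s * t)))
      {s : ℂ | 0 < s.re} := by
  intro s hs
  rw [mem_ofPred_eq] at hs
  have hU : {z : ℂ | s.re / 2 < z.re} ∈ 𝓝 s :=
    (isOpen_lt continuous_const Complex.continuous_re).mem_nhds (by simp; linarith)
  refine (hasDerivAt_integral_of_dominated_loc_of_deriv_le (μ := volume.restrict (Ioi (0 : ℝ)))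
    (F := fun (z : ℂ) (t : ℝ) => ((t ^ q : ℝ) : ℂ) * Complex.exp (-(z * t)))
    (F' := fun (z : ℂ) (t : ℝ) => ((t ^ q : ℝ) : ℂ) * (Complex.exp (-(z * t)) * (-t)))
    (bound := fun t => t ^ (q + 1) * Real.exp (-(s.re / 2 * t))) hU
    (Eventually.of_forall fun z => aestronglyMeasurable_rpow_mul_cexp _ _ _)
    (integrableOn_rpow_mul_cexp_neg_mul hq hs) ?_ ?_
    (integrableOn_rpow_mul_exp_neg_mul (by linarith) (by linarith)) ?_).2.differentiableAt.differentiableWithinAt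
  · have := (aestronglyMeasurable_rpow_mul_cexp q s (volume.restrict (Ioi (0 : ℝ)))).mul
      (g := fun t : ℝ => -(t : ℂ)) (by fun_prop)
    exact this.congr (Eventually.of_forall fun t => by simp only [Pi.mul_apply]; ring)
  · filter_upwards [ae_restrict_mem measurableSet_Ioi] with t ht z hz
    simp only [mem_Ioi] at ht hz
    rw [← mul_assoc, norm_mul, norm_rpow_mul_cexp_neg_mul ht, norm_neg,
      Complex.norm_of_nonneg ht.le, Real.rpow_add ht, Real.rpow_one]
    have : Real.exp (-(z.re * t)) ≤ Real.exp (-(s.re / 2 * t)) := by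
      gcongr
    calc _ = t ^ q * t * Real.exp (-(z.re * t)) := by ring
      _ ≤ _ := by gcongr
  · filter_upwards with t z hz
    have : HasDerivAt (fun z : ℂ => -(z * t)) (-t : ℂ) z :=
      ((hasDerivAt_id z).mul_const (t : ℂ)).neg.congr_deriv (by simp)
    exact (this.cexp).const_mul _

theorem integral_rpow_mul_cexp_neg_mul {p : ℝ} {s : ℂ} (hp : 0 < p) (hs : 0 < s.re) :
    ∫ t in Ioi (0 : ℝ), ((t ^ (p - 1) : ℝ) : ℂ) * Complex.exp (-(s * t)) =
      s ^ (-p : ℂ) * Real.Gamma p := by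
  have hopen : IsOpen {s : ℂ | 0 < s.re} := isOpen_lt continuous_const Complex.continuous_re
  have h1 := (differentiableOn_integral_rpow_mul_cexp_neg_mul
    (q := p - 1) (by linarith)).analyticOnNhd hopen
  have h2 : AnalyticOnNhd ℂ (fun s : ℂ => s ^ (-p : ℂ) * (Real.Gamma p : ℂ))
      {s : ℂ | 0 < s.re} := by
    refine DifferentiableOn.analyticOnNhd ?_ hopen
    intro z hz
    refine DifferentiableAt.differentiableWithinAt ?_
    have : z ∈ slitPlane := Or.inl hz
    fun_prop (disch := assumption)
  have hpre : IsPreconnected {s : ℂ | 0 < s.re} :=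
    (convex_halfSpace_re_gt 0).isPreconnected
  refine h1.eqOn_of_preconnected_of_frequently_eq h2 hpre (z₀ := 1) (by simp) ?_ hs
  have hreal : ∀ r : ℝ, 0 < r →
      ∫ t in Ioi (0 : ℝ), ((t ^ (p - 1) : ℝ) : ℂ) * Complex.exp (-((r : ℂ) * t)) =
      (r : ℂ) ^ (-p : ℂ) * Real.Gamma p := by
    intro r hr
    have := Complex.integral_cpow_mul_exp_neg_mul_Ioi (a := p) (by simpa using hp) hr
    rw [Complex.Gamma_ofReal] at this
    rw [Complex.cpow_neg, ← Complex.inv_cpow, ← one_div, ← this]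
    · refine setIntegral_congr_fun measurableSet_Ioi fun t ht => ?_
      simp only [mem_Ioi] at ht
      simp only [Complex.ofReal_cpow ht.le]
      push_cast; rfl
    · rw [Complex.arg_ofReal_of_nonneg hr.le]; exact Real.pi_pos.ne
  have ht : Tendsto (fun r : ℝ => (r : ℂ)) (𝓝[≠] 1) (𝓝[≠] 1) := by
    refine tendsto_nhdsWithin_iff.2 ⟨?_, ?_⟩
    · exact (Complex.continuous_ofReal.tendsto' 1 1 (by simp)).mono_left nhdsWithin_le_nhds
    · filter_upwards [self_mem_nhdsWithin] with r hr
      simpa using hr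
  refine ht.frequently (Eventually.frequently ?_)
  filter_upwards [nhdsWithin_le_nhds (lt_mem_nhds one_pos)] with r hr
  exact hreal r hr

theorem one_add_abs_le_two_mul_norm {c : ℝ} (hc : 1 ≤ c) (ω : ℝ) :
    1 + |ω| ≤ 2 * ‖(c : ℂ) + ω * I‖ := by
  have h1 := Complex.abs_re_le_norm ((c : ℂ) + ω * I)
  have h2 := Complex.abs_im_le_norm ((c : ℂ) + ω * I)
  simp at h1 h2
  have := le_abs_self c
  linarith

theorem norm_vertical_rpow_neg_le {c r : ℝ} (hc : 1 ≤ c) (hr : 0 ≤ r) (ω : ℝ) :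
    ‖(c : ℂ) + ω * I‖ ^ (-r) ≤ 2 ^ r * (1 + ‖ω‖) ^ (-r) := by
  have h := one_add_abs_le_two_mul_norm hc ω
  have h0 : 0 < 1 + |ω| := by positivity
  calc ‖(c : ℂ) + ω * I‖ ^ (-r) ≤ ((1 + |ω|) / 2) ^ (-r) :=
        Real.rpow_le_rpow_of_nonpos (by positivity) (by linarith) (by linarith)
    _ = _ := by
        rw [Real.div_rpow h0.le (by norm_num), Real.rpow_neg (by norm_num : (0:ℝ) ≤ 2)]
        simp; ring

theorem integrable_one_add_norm_rpow_neg {r : ℝ} (hr : 1 < r) :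
    Integrable fun ω : ℝ => 2 ^ r * (1 + ‖ω‖) ^ (-r) :=
  (integrable_one_add_norm (by simpa using hr)).const_mul _

theorem vertical_mem_slitPlane {c : ℝ} (hc : 0 < c) (ω : ℝ) :
    (c : ℂ) + ω * I ∈ slitPlane := Or.inl (by simpa using hc)

theorem integrable_norm_vertical_rpow_neg {c r : ℝ} (hc : 1 ≤ c) (hr : 1 < r) :
    Integrable fun ω : ℝ => ‖(c : ℂ) + ω * I‖ ^ (-r) := by
  refine (integrable_one_add_norm_rpow_neg hr).mono' ?_ ?_
  · refine Continuous.aestronglyMeasurable ?_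
    refine Continuous.rpow_const (by fun_prop) fun ω => Or.inl ?_
    exact norm_ne_zero_iff.2 (slitPlane_ne_zero (vertical_mem_slitPlane (by linarith) ω))
  · filter_upwards with ω
    rw [Real.norm_of_nonneg (by positivity)]
    exact norm_vertical_rpow_neg_le hc (by linarith) ω

theorem continuous_vertical_cpow {c : ℝ} (hc : 0 < c) (z : ℂ) :
    Continuous fun ω : ℝ => ((c : ℂ) + ω * I) ^ z :=
  Continuous.cpow (by fun_prop) continuous_const fun ω => vertical_mem_slitPlane hc ω

theorem integral_cexp_mul_cpow_neg_vertical {p c : ℝ} (hp : 1 < p) (hc : 1 ≤ c) :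
    ∫ ω : ℝ, Complex.exp (c + ω * I) * ((c : ℂ) + ω * I) ^ (-p : ℂ) =
      2 * π / Real.Gamma p := by
  have hc0 : 0 < c := by linarith
  set f : ℝ → ℂ := (Ioi (0 : ℝ)).indicator
    fun t => ((t ^ (p - 1) : ℝ) : ℂ) * Complex.exp (-((c : ℂ) * t)) with hf
  have hfi : Integrable f := by
    rw [hf, integrable_indicator_iff measurableSet_Ioi]
    exact integrableOn_rpow_mul_cexp_neg_mul (by linarith) (by simpa using hc0)
  have hF : FourierTransform.fourier f = fun ξ : ℝ =>
      ((c : ℂ) + (2 * π * ξ : ℝ) * I) ^ (-p : ℂ) * Real.Gamma p := by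
    ext ξ
    rw [Real.fourier_real_eq_integral_exp_smul,
      ← integral_rpow_mul_cexp_neg_mul (by linarith) (by simpa using hc0),
      ← integral_indicator measurableSet_Ioi]
    congr 1 with t
    simp only [hf, indicator]
    split_ifs
    · rw [smul_eq_mul, mul_left_comm, ← Complex.exp_add]
      congr 2
      push_cast; ring
    · simp
  have hFi : Integrable (FourierTransform.fourier f) := by
    rw [hF]
    refine Integrable.mul_const ?_ _
    refine Integrable.comp_mul_left' (g := fun ω : ℝ => ((c : ℂ) + ω * I) ^ (-p : ℂ)) ?_
      (by positivity)
    refine (integrable_norm_vertical_rpow_neg hc hp).mono'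
      (continuous_vertical_cpow hc0 _).aestronglyMeasurable ?_
    filter_upwards with ω
    rw [← Complex.ofReal_neg, Complex.norm_cpow_real]
  have hcont : ContinuousAt f 1 := by
    have h1 : ContinuousAt
        (fun t : ℝ => ((t ^ (p - 1) : ℝ) : ℂ) * Complex.exp (-((c : ℂ) * t))) 1 := by
      have : ContinuousAt (fun t : ℝ => t ^ (p - 1)) 1 :=
        Real.continuousAt_rpow_const _ _ (Or.inl one_ne_zero)
      fun_prop
    refine h1.congr ?_
    filter_upwards [lt_mem_nhds one_pos] with t ht
    simp only [hf]
    rw [indicator_of_mem (by exact ht)]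
  have key := hfi.fourierInv_fourier_eq hFi hcont
  rw [Real.fourierInv_eq', hF] at key
  have hf1 : f 1 = Complex.exp (-c) := by simp [hf]
  rw [hf1] at key
  have hG : (Real.Gamma p : ℂ) ≠ 0 := by
    exact_mod_cast (Real.Gamma_pos_of_pos (by linarith)).ne'
  have hsub := Measure.integral_comp_mul_left
    (fun ω : ℝ => Complex.exp (c + ω * I) * ((c : ℂ) + ω * I) ^ (-p : ℂ)) (2 * π)
  have hkey2 : (∫ ξ : ℝ, (Complex.exp (c + (2 * π * ξ : ℝ) * I) *
      ((c : ℂ) + (2 * π * ξ : ℝ) * I) ^ (-p : ℂ))) * (Real.Gamma p) = 1 := by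
    have : (1 : ℂ) = Complex.exp c * Complex.exp (-c) := by
      rw [← Complex.exp_add]; simp
    rw [this, ← key, ← integral_const_mul, ← integral_mul_const]
    congr 1 with ξ
    rw [Complex.exp_add]
    simp only [smul_eq_mul, RCLike.inner_apply, conj_trivial, one_mul]
    ring
  rw [hsub, abs_of_pos (by positivity)] at hkey2
  rw [eq_div_iff hG]
  simp only [Complex.real_smul] at hkey2
  have hpi : (π : ℂ) ≠ 0 := by exact_mod_cast Real.pi_ne_zero
  push_cast at hkey2
  field_simp at hkey2
  linear_combination hkey2

theorem integral_vertical_eq_of_norm_le {h : ℂ → ℂ} {c₁ c₂ M r : ℝ} (hc : c₁ ≤ c₂) (hr : 1 < r)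
    (hd : ∀ s : ℂ, c₁ ≤ s.re → s.re ≤ c₂ → DifferentiableAt ℂ h s)
    (hM : ∀ c ∈ Icc c₁ c₂, ∀ ω : ℝ, ‖h (c + ω * I)‖ ≤ M * (1 + ‖ω‖) ^ (-r)) :
    ∫ ω : ℝ, h (c₁ + ω * I) = ∫ ω : ℝ, h (c₂ + ω * I) := by
  have hint : ∀ c ∈ Icc c₁ c₂, Integrable fun ω : ℝ => h (c + ω * I) := by
    intro c hc'
    refine (((integrable_one_add_norm (by simpa using hr)).const_mul M).mono'
      (Continuous.aestronglyMeasurable ?_) (Eventually.of_forall (hM c hc')))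
    refine continuous_iff_continuousAt.2 fun ω => ?_
    have := (hd (c + ω * I) (by simpa using hc'.1) (by simpa using hc'.2)).continuousAt
    exact ContinuousAt.comp (f := fun ω : ℝ => (c : ℂ) + ω * I) this (by fun_prop)
  have hlim : ∀ c ∈ Icc c₁ c₂, Tendsto (fun R : ℝ => ∫ ω in (-R)..R, h (c + ω * I)) atTop
      (𝓝 (∫ ω : ℝ, h (c + ω * I))) := fun c hc' =>
    intervalIntegral_tendsto_integral (hint c hc') tendsto_neg_atTop_atBot tendsto_id
  have hB : Tendsto (fun R : ℝ => M * (1 + ‖R‖) ^ (-r) * |c₂ - c₁|) atTop (𝓝 0) := by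
    have h1 : Tendsto (fun R : ℝ => 1 + ‖R‖) atTop atTop :=
      tendsto_atTop_add_const_left _ _ tendsto_norm_atTop_atTop
    have h2 := (tendsto_rpow_neg_atTop (by linarith : 0 < r)).comp h1
    simpa using (h2.const_mul M).mul_const |c₂ - c₁|
  have hedge : ∀ R : ℝ, ‖∫ x in c₁..c₂, h (x + R * I)‖ ≤ M * (1 + ‖R‖) ^ (-r) * |c₂ - c₁| := by
    intro R
    refine intervalIntegral.norm_integral_le_of_norm_le_const fun x hx => ?_
    rw [uIoc_of_le hc] at hx
    exact hM x ⟨hx.1.le, hx.2⟩ R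
  have hdiff : ∀ R : ℝ, ‖(∫ ω in (-R)..R, h (c₂ + ω * I)) - ∫ ω in (-R)..R, h (c₁ + ω * I)‖ ≤
      2 * (M * (1 + ‖R‖) ^ (-r) * |c₂ - c₁|) := by
    intro R
    have hrect := Complex.integral_boundary_rect_eq_zero_of_differentiableOn h
      ⟨c₁, -R⟩ ⟨c₂, R⟩ (by
        intro s hs
        rw [mem_reProdIm, uIcc_of_le hc] at hs
        exact (hd s hs.1.1 hs.1.2).differentiableWithinAt)
    simp only [smul_eq_mul] at hrect
    have e1 := hedge (-R)
    have e2 := hedge R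
    rw [norm_neg] at e1
    have : I * ((∫ ω in (-R)..R, h (c₂ + ω * I)) - ∫ ω in (-R)..R, h (c₁ + ω * I)) =
        (∫ x in c₁..c₂, h (x + R * I)) - ∫ x in c₁..c₂, h (x + (-R : ℝ) * I) := by
      linear_combination hrect
    calc _ = ‖I * ((∫ ω in (-R)..R, h (c₂ + ω * I)) - ∫ ω in (-R)..R, h (c₁ + ω * I))‖ := by
          rw [norm_mul, Complex.norm_I, one_mul]
      _ ≤ _ := by
          rw [this]
          refine (norm_sub_le _ _).trans ?_
          linarith
  have hzero : Tendsto (fun R : ℝ => (∫ ω in (-R)..R, h (c₂ + ω * I)) -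
      ∫ ω in (-R)..R, h (c₁ + ω * I)) atTop (𝓝 0) :=
    squeeze_zero_norm hdiff (by simpa using hB.const_mul 2)
  have := tendsto_nhds_unique ((hlim c₂ ⟨hc, le_rfl⟩).sub (hlim c₁ ⟨le_rfl, hc⟩)) hzero
  exact (sub_eq_zero.1 this).symm

theorem cos_mul_le_norm_cpow_add {α x : ℝ} (hα0 : 0 ≤ α) (hα : α ≤ 2) (hx : 0 ≤ x) {s : ℂ}
    (hs : 0 ≤ s.re) :
    Real.cos (α * π / 4) * (‖s‖ ^ α + x) ≤ ‖s ^ (α : ℂ) + x‖ := by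
  set k := Real.cos (α * π / 4)
  have hpi := Real.pi_pos
  have hk : 0 ≤ k := Real.cos_nonneg_of_mem_Icc ⟨by nlinarith, by nlinarith⟩
  have hcos : Real.cos (α * π / 2) = 2 * k ^ 2 - 1 := by
    rw [← Real.cos_two_mul]
    ring_nf
  have harg : |s.arg| ≤ π / 2 := Complex.abs_arg_le_pi_div_two_iff.2 hs
  have hre : ‖s‖ ^ α * (2 * k ^ 2 - 1) ≤ (s ^ (α : ℂ)).re := by
    rw [Complex.cpow_ofReal_re, ← hcos]
    refine mul_le_mul_of_nonneg_left ?_ (by positivity)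
    rw [← Real.cos_abs (s.arg * α), abs_mul, abs_of_nonneg hα0]
    refine Real.cos_le_cos_of_nonneg_of_le_pi (by positivity) (by nlinarith) (by nlinarith)
  have hn : ‖s ^ (α : ℂ)‖ = ‖s‖ ^ α := Complex.norm_cpow_real _ _
  refine (pow_le_pow_iff_left₀ (by positivity) (norm_nonneg _) two_ne_zero).1 ?_
  have hsq : ‖s ^ (α : ℂ) + x‖ ^ 2 = (‖s‖ ^ α) ^ 2 + x ^ 2 + 2 * (x * (s ^ (α : ℂ)).re) := by
    rw [Complex.sq_norm, Complex.normSq_add, ← Complex.sq_norm, hn]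
    simp [Complex.normSq_ofReal]
    ring
  rw [hsq]
  have hk1 : k ^ 2 ≤ 1 := Real.cos_sq_le_one _
  nlinarith [mul_le_mul_of_nonneg_left hre hx,
    mul_nonneg (sub_nonneg.2 hk1) (sq_nonneg (‖s‖ ^ α - x))]

/-- Up to the factor `exp s / (2π)`, the Laplace-type kernel whose integral over a vertical line
is `E_{α,β}(-x)`. -/
noncomputable def mittagLefflerKernel (α β x : ℝ) (s : ℂ) : ℂ :=
  s ^ (-(β + 1 : ℝ) : ℂ) *
    (s ^ (α : ℂ) / (s ^ (α : ℂ) + x) * (β + α * (s ^ (α : ℂ) / (s ^ (α : ℂ) + x) - 1)))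

theorem cos_mul_pi_div_four_pos {α : ℝ} (hα0 : 0 ≤ α) (hα : α < 2) :
    0 < Real.cos (α * π / 4) := by
  have hpi := Real.pi_pos
  exact Real.cos_pos_of_mem_Ioo ⟨by nlinarith, by nlinarith⟩

theorem cpow_add_ne_zero {α x : ℝ} (hα0 : 0 ≤ α) (hα : α < 2) (hx : 0 ≤ x) {s : ℂ}
    (hs : 0 < s.re) : s ^ (α : ℂ) + x ≠ 0 := by
  have h := cos_mul_le_norm_cpow_add hα0 hα.le hx hs.le
  have hs0 : s ≠ 0 := by rintro rfl; simp at hs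
  have h0 : 0 < ‖s‖ ^ α := Real.rpow_pos_of_pos (norm_pos_iff.2 hs0) _
  have := mul_pos (cos_mul_pi_div_four_pos hα0 hα) (by linarith : 0 < ‖s‖ ^ α + x)
  exact norm_pos_iff.1 (this.trans_le h)

theorem differentiableAt_mittagLefflerKernel {α β x : ℝ} (hα0 : 0 ≤ α) (hα : α < 2)
    (hx : 0 ≤ x) {s : ℂ} (hs : 0 < s.re) :
    DifferentiableAt ℂ (mittagLefflerKernel α β x) s := by
  have h1 : s ∈ slitPlane := Or.inl hs
  have h2 := cpow_add_ne_zero hα0 hα hx hs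
  unfold mittagLefflerKernel
  fun_prop (disch := assumption)

theorem exists_norm_mittagLefflerKernel_le {α β θ : ℝ} (hα0 : 0 ≤ α) (hα : α < 2)
    (hβ : 0 < β) (hθ0 : 0 ≤ θ) (hθ1 : θ ≤ 1) :
    ∃ K : ℝ, 0 < K ∧ ∀ x : ℝ, 0 < x → ∀ s : ℂ, 0 < s.re →
      ‖mittagLefflerKernel α β x s‖ ≤ K * x ^ (-θ) * ‖s‖ ^ (-(β + 1 - α * θ)) := by
  set κ := Real.cos (α * π / 4)
  have hκ : 0 < κ := cos_mul_pi_div_four_pos hα0 hα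
  refine ⟨κ⁻¹ * (β + α * (κ⁻¹ + 1)), by positivity, fun x hx s hs => ?_⟩
  have hs0 : 0 < ‖s‖ := norm_pos_iff.2 (by rintro rfl; simp at hs)
  set q := s ^ (α : ℂ) / (s ^ (α : ℂ) + x) with hq
  set y := ‖s‖ ^ α / (‖s‖ ^ α + x) with hy
  have hy1 : y ≤ 1 := div_le_one_of_le₀ (by linarith) (by positivity)
  have hy0 : 0 < y := by positivity
  have hqy : ‖q‖ ≤ κ⁻¹ * y := by
    rw [hq, norm_div, Complex.norm_cpow_real, hy, inv_mul_eq_div, div_div, mul_comm _ κ]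
    exact div_le_div_of_nonneg_left (by positivity) (by positivity)
      (cos_mul_le_norm_cpow_add hα0 hα.le hx.le hs.le)
  have hq1 : ‖q‖ ≤ κ⁻¹ := hqy.trans (mul_le_of_le_one_right (by positivity) hy1)
  have hyθ : y ≤ ‖s‖ ^ (α * θ) * x ^ (-θ) := by
    calc y ≤ y ^ θ := by
          simpa using Real.rpow_le_rpow_of_exponent_ge hy0 hy1 hθ1
      _ ≤ (‖s‖ ^ α / x) ^ θ := by
          refine Real.rpow_le_rpow hy0.le ?_ hθ0
          exact div_le_div_of_nonneg_left (by positivity) hx (by linarith [Real.rpow_pos_of_pos hs0 α])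
      _ = _ := by
          rw [Real.div_rpow (by positivity) hx.le, Real.rpow_mul hs0.le, Real.rpow_neg hx.le,
            div_eq_mul_inv]
  have hfac : ‖(β : ℂ) + α * (q - 1)‖ ≤ β + α * (κ⁻¹ + 1) := by
    refine (norm_add_le _ _).trans ?_
    rw [norm_mul, Complex.norm_of_nonneg hβ.le, Complex.norm_of_nonneg hα0]
    gcongr
    refine (norm_sub_le _ _).trans ?_
    simpa using hq1
  have hpow : ‖s‖ ^ (-(β + 1 - α * θ)) = ‖s‖ ^ (-(β + 1)) * ‖s‖ ^ (α * θ) := by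
    rw [← Real.rpow_add hs0]; ring_nf
  rw [mittagLefflerKernel, norm_mul, norm_mul, ← Complex.ofReal_neg, Complex.norm_cpow_real, hpow]
  calc ‖s‖ ^ (-(β + 1)) * (‖q‖ * ‖(β : ℂ) + α * (q - 1)‖)
      ≤ ‖s‖ ^ (-(β + 1)) * ((κ⁻¹ * (‖s‖ ^ (α * θ) * x ^ (-θ))) * (β + α * (κ⁻¹ + 1))) := by
        gcongr
        exact hqy.trans (by gcongr)
    _ = _ := by ring

theorem cpow_neg_mul_nat_add {s : ℂ} (hs : s ≠ 0) (α β : ℝ) (k : ℕ) :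
    s ^ (-(α * k + β : ℝ) : ℂ) = s ^ (-β : ℂ) * (s ^ (-α : ℂ)) ^ k := by
  rw [← Complex.cpow_nat_mul, ← Complex.cpow_add _ _ hs]
  congr 1
  push_cast; ring

theorem hasSum_mittagLefflerKernel {α x : ℝ} (β : ℝ) {s : ℂ} (hs : s ≠ 0)
    (hx : |x| < ‖s‖ ^ α) :
    HasSum (fun k : ℕ => (-x : ℂ) ^ k * ((α * k + β : ℝ) * s ^ (-(α * k + (β + 1) : ℝ) : ℂ)))
      (mittagLefflerKernel α β x s) := by
  set z := s ^ (α : ℂ) with hz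
  have hzn : ‖z‖ = ‖s‖ ^ α := Complex.norm_cpow_real _ _
  have hz0 : z ≠ 0 := by rw [hz, Complex.cpow_ne_zero_iff]; exact Or.inl hs
  have hzi : s ^ (-α : ℂ) = z⁻¹ := Complex.cpow_neg _ _
  set w : ℂ := -x * z⁻¹ with hw
  have hwn : ‖w‖ < 1 := by
    rw [hw, norm_mul, norm_inv, hzn, norm_neg, Complex.norm_real, Real.norm_eq_abs,
      ← div_eq_mul_inv]
    exact (div_lt_one ((abs_nonneg x).trans_lt hx)).2 hx
  have hzx : z + x ≠ 0 := by
    intro h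
    have : ‖z‖ = |x| := by
      rw [eq_neg_of_add_eq_zero_left h, norm_neg, Complex.norm_real, Real.norm_eq_abs]
    rw [hzn] at this
    exact hx.ne' this
  have h1w : 1 - w = (z + x) / z := by rw [hw]; field_simp; ring
  have h1 := (hasSum_coe_mul_geometric_of_norm_lt_one hwn).mul_left (α : ℂ)
  have h2 := (hasSum_geometric_of_norm_lt_one hwn).mul_left (β : ℂ)
  have h3 := (h1.add h2).mul_left (s ^ (-(β + 1 : ℝ) : ℂ))
  have hval : mittagLefflerKernel α β x s = s ^ (-(β + 1 : ℝ) : ℂ) *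
      (α * (w / (1 - w) ^ 2) + β * (1 - w)⁻¹) := by
    rw [mittagLefflerKernel, ← hz, h1w, hw]
    congr 1
    field_simp
    ring
  rw [hval]
  refine h3.congr_fun fun k => ?_
  rw [cpow_neg_mul_nat_add hs, hzi, hw, mul_pow]
  push_cast
  ring

theorem mittagLeffler_eq_integral_vertical {α β x c : ℝ} (hα0 : 0 < α) (hβ : 0 < β)
    (hx : 0 ≤ x) (hc : 1 ≤ c) (hxc : x < c ^ α) :
    mittagLeffler α β ((-x : ℝ) : ℂ) = (2 * π : ℂ)⁻¹ *
      ∫ ω : ℝ, Complex.exp (c + ω * I) * mittagLefflerKernel α β x (c + ω * I) := by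
  have hc0 : 0 < c := by linarith
  have hs0 : ∀ ω : ℝ, (c : ℂ) + ω * I ≠ 0 := fun ω =>
    slitPlane_ne_zero (vertical_mem_slitPlane hc0 ω)
  have hcn : ∀ ω : ℝ, c ≤ ‖(c : ℂ) + ω * I‖ := fun ω => by
    have := Complex.re_le_norm ((c : ℂ) + ω * I)
    simpa using this
  have hexp : ∀ ω : ℝ, ‖Complex.exp (c + ω * I)‖ = Real.exp c := fun ω => by
    rw [Complex.norm_exp]; simp
  set F : ℕ → ℝ → ℂ := fun k ω => Complex.exp (c + ω * I) * ((-x : ℂ) ^ k *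
    ((α * k + β : ℝ) * ((c : ℂ) + ω * I) ^ (-(α * k + (β + 1) : ℝ) : ℂ))) with hF
  have hnorm : ∀ k ω, ‖F k ω‖ = Real.exp c * (x ^ k * ((α * k + β) *
      ‖(c : ℂ) + ω * I‖ ^ (-(α * k + (β + 1))))) := by
    intro k ω
    simp only [hF]
    rw [norm_mul, norm_mul, norm_mul, hexp, ← Complex.ofReal_neg (_ + _), Complex.norm_cpow_real,
      Complex.norm_of_nonneg (by positivity), norm_pow, norm_neg, Complex.norm_of_nonneg hx]
  have hle : ∀ k ω, ‖F k ω‖ ≤ (Real.exp c * ((α * k + β) * (x / c ^ α) ^ k)) *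
      ‖(c : ℂ) + ω * I‖ ^ (-(β + 1)) := by
    intro k ω
    have hn : 0 < ‖(c : ℂ) + ω * I‖ := norm_pos_iff.2 (hs0 ω)
    have h1 : ‖(c : ℂ) + ω * I‖ ^ (-(α * k + (β + 1))) ≤
        (c ^ α)⁻¹ ^ k * ‖(c : ℂ) + ω * I‖ ^ (-(β + 1)) := by
      rw [neg_add, Real.rpow_add hn]
      gcongr
      rw [← Real.rpow_neg hc0.le, ← Real.rpow_mul_natCast hc0.le, neg_mul]
      refine Real.rpow_le_rpow_of_nonpos hc0 (hcn ω) ?_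
      have : 0 ≤ α * k := by positivity
      linarith
    rw [hnorm, div_pow, div_eq_mul_inv, ← inv_pow]
    calc _ ≤ Real.exp c * (x ^ k * ((α * k + β) *
        ((c ^ α)⁻¹ ^ k * ‖(c : ℂ) + ω * I‖ ^ (-(β + 1))))) := by gcongr
      _ = _ := by ring
  have hr : Integrable fun ω : ℝ => ‖(c : ℂ) + ω * I‖ ^ (-(β + 1)) :=
    integrable_norm_vertical_rpow_neg hc (by linarith)
  have hFi : ∀ k, Integrable (F k) := by
    intro k
    refine (hr.const_mul _).mono' (Continuous.aestronglyMeasurable ?_)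
      (Eventually.of_forall (hle k))
    have := continuous_vertical_cpow hc0 (-(α * k + (β + 1) : ℝ) : ℂ)
    fun_prop
  have hratio : ‖x / c ^ α‖ < 1 := by
    rw [Real.norm_of_nonneg (by positivity)]
    exact (div_lt_one (by positivity)).2 hxc
  have hsum : Summable fun k => ∫ ω, ‖F k ω‖ := by
    have hs1 := ((hasSum_coe_mul_geometric_of_norm_lt_one hratio).mul_left α).summable
    have hs2 := ((hasSum_geometric_of_norm_lt_one hratio).mul_left β).summable
    have hs3 := ((hs1.add hs2).mul_left (Real.exp c)).mul_right
      (∫ ω : ℝ, ‖(c : ℂ) + ω * I‖ ^ (-(β + 1)))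
    refine Summable.of_nonneg_of_le (fun k => by positivity) (fun k => ?_) hs3
    calc _ ≤ ∫ ω : ℝ, (Real.exp c * ((α * k + β) * (x / c ^ α) ^ k)) *
          ‖(c : ℂ) + ω * I‖ ^ (-(β + 1)) :=
          integral_mono (hFi k).norm (hr.const_mul _) (hle k)
      _ = _ := by rw [integral_const_mul]; ring
  have key := hasSum_integral_of_summable_integral_norm hFi hsum
  have htsum : ∀ ω, ∑' k, F k ω =
      Complex.exp (c + ω * I) * mittagLefflerKernel α β x (c + ω * I) := by
    intro ω
    refine ((hasSum_mittagLefflerKernel β (hs0 ω) ?_).mul_left _).tsum_eq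
    rw [abs_of_nonneg hx]
    exact hxc.trans_le (Real.rpow_le_rpow hc0.le (hcn ω) hα0.le)
  simp only [htsum] at key
  rw [mittagLeffler, ← (key.mul_left ((2 * π : ℂ)⁻¹)).tsum_eq]
  congr 1 with k
  have hp : 0 < α * k + β := by positivity
  have hGam : ∫ ω, F k ω = (-x : ℂ) ^ k * ((α * k + β : ℝ) *
      (2 * π / Real.Gamma (α * k + (β + 1)))) := by
    rw [← integral_cexp_mul_cpow_neg_vertical (by linarith) hc, ← integral_const_mul,
      ← integral_const_mul]
    congr 1 with ω
    simp only [hF]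
    ring
  have hG0 : (Real.Gamma (α * k + β) : ℂ) ≠ 0 := by
    exact_mod_cast (Real.Gamma_pos_of_pos hp).ne'
  have hpi : (π : ℂ) ≠ 0 := by exact_mod_cast Real.pi_ne_zero
  have hp' : ((α * k + β : ℝ) : ℂ) ≠ 0 := by exact_mod_cast hp.ne'
  rw [hGam, Complex.Gamma_ofReal, ← add_assoc, Real.Gamma_add_one hp.ne']
  rw [Complex.ofReal_mul, Complex.ofReal_neg]
  field_simp

/-- Decay of the Mittag–Leffler function on the negative half-line. -/
theorem exists_norm_mittagLeffler_neg_le {α β θ : ℝ} (hα1 : 1 ≤ α) (hα : α < 2) (hβ : 0 < β)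
    (hθ0 : 0 ≤ θ) (hθ1 : θ ≤ 1) (hθ : α * θ < β) :
    ∃ C : ℝ, 0 < C ∧ ∀ x : ℝ, 0 < x →
      ‖mittagLeffler α β ((-x : ℝ) : ℂ)‖ ≤ C * x ^ (-θ) := by
  have hα0 : 0 < α := by linarith
  obtain ⟨K, hK0, hK⟩ := exists_norm_mittagLefflerKernel_le (θ := θ) hα0.le hα hβ hθ0 hθ1
  obtain ⟨r, hr⟩ : ∃ r, r = β + 1 - α * θ := ⟨_, rfl⟩
  rw [← hr] at hK
  have hr1 : 1 < r := by linarith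
  set J := ∫ ω : ℝ, ‖((1 : ℝ) : ℂ) + ω * I‖ ^ (-r) with hJ
  have hJ0 : 0 ≤ J := integral_nonneg fun ω => by positivity
  refine ⟨(2 * π)⁻¹ * (Real.exp 1 * K * (J + 1)), by positivity, fun x hx => ?_⟩
  have hbound : ∀ c : ℝ, 1 ≤ c → ∀ ω : ℝ,
      ‖Complex.exp (c + ω * I) * mittagLefflerKernel α β x (c + ω * I)‖ ≤
        Real.exp c * (K * x ^ (-θ) * ‖(c : ℂ) + ω * I‖ ^ (-r)) := by
    intro c hc ω
    have hre : ((c : ℂ) + ω * I).re = c := by simp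
    rw [norm_mul, Complex.norm_exp, hre]
    gcongr
    exact hK x hx _ (by rw [hre]; linarith)
  have hxc : x < (1 + x) ^ α := by
    have := Real.rpow_le_rpow_of_exponent_le (by linarith : 1 ≤ 1 + x) hα1
    rw [Real.rpow_one] at this
    linarith
  have hshift := integral_vertical_eq_of_norm_le (c₁ := 1) (c₂ := 1 + x) (r := r)
    (h := fun s => Complex.exp s * mittagLefflerKernel α β x s)
    (M := Real.exp (1 + x) * (K * x ^ (-θ) * 2 ^ r)) (by linarith) hr1
    (fun s hs _ => Complex.differentiable_exp.differentiableAt.mul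
      (differentiableAt_mittagLefflerKernel hα0.le hα hx.le (by linarith)))
    (fun c hc ω => by
      refine (hbound c hc.1 ω).trans ?_
      have h1 := norm_vertical_rpow_neg_le hc.1 (by linarith : 0 ≤ r) ω
      calc _ ≤ Real.exp (1 + x) * (K * x ^ (-θ) * (2 ^ r * (1 + ‖ω‖) ^ (-r))) := by
            gcongr
            exact hc.2
        _ = _ := by ring)
  rw [mittagLeffler_eq_integral_vertical hα0 hβ hx.le (by linarith) hxc, ← hshift, norm_mul]
  have hpi : ‖(2 * π : ℂ)⁻¹‖ = (2 * π)⁻¹ := by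
    rw [norm_inv, norm_mul, Complex.norm_of_nonneg Real.pi_pos.le]; simp
  rw [hpi, mul_assoc]
  gcongr
  calc _ ≤ ∫ ω : ℝ, Real.exp 1 * (K * x ^ (-θ) * ‖((1 : ℝ) : ℂ) + ω * I‖ ^ (-r)) := by
        refine norm_integral_le_of_norm_le ?_ (Eventually.of_forall (hbound 1 le_rfl))
        exact ((integrable_norm_vertical_rpow_neg le_rfl hr1).const_mul _).const_mul _
    _ = Real.exp 1 * (K * x ^ (-θ) * J) := by rw [integral_const_mul, integral_const_mul]
    _ ≤ Real.exp 1 * (K * x ^ (-θ) * (J + 1)) := by gcongr; linarith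
    _ = _ := by ring

end Auxiliary

/-- Spectral-coefficient form of the pointwise estimate
`‖∂_t^α u(t,·)‖²_{D(A^{-1/(2α)})} ≤ C t^{1-α} ‖u₀‖²_{H¹₀} + C t^{3-2α} ‖u₁‖²_{L²}`. -/
theorem fractional_derivative_pointwise_estimate (α T : ℝ) (hα1 : 1 < α) (hα2 : α < 2)
    (hT : 0 < T)
    (lam a b : ℕ → ℝ) (hlam : ∀ n, 0 < lam n)
    (ha : Summable (fun n => lam n * (a n) ^ 2))
    (hb : Summable (fun n => (b n) ^ 2)) :
    ∃ C : ℝ, 0 < C ∧ ∀ t ∈ Set.Ioc (0 : ℝ) T,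
      ∑' n : ℕ, (lam n) ^ (-1 / α) * (lam n) ^ 2 *
          ‖((a n : ℝ) : ℂ) * mittagLeffler α 1 ((-(lam n * t ^ α) : ℝ) : ℂ)
            + ((b n * t : ℝ) : ℂ) * mittagLeffler α 2 ((-(lam n * t ^ α) : ℝ) : ℂ)‖ ^ 2
        ≤ C * t ^ (1 - α) * (∑' n : ℕ, lam n * (a n) ^ 2)
          + C * t ^ (3 - 2 * α) * ∑' n : ℕ, (b n) ^ 2 := by
  have hα0 : 0 < α := by linarith
  have hinv : α * α⁻¹ = 1 := mul_inv_cancel₀ hα0.ne'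
  have hi0 : 0 < α⁻¹ := by positivity
  have hi1 : α⁻¹ < 1 := inv_lt_one_of_one_lt₀ hα1
  obtain ⟨K₁, hK₁, hE₁⟩ := exists_norm_mittagLeffler_neg_le (β := 1) (θ := (1 - α⁻¹) / 2)
    hα1.le hα2 one_pos (by linarith) (by linarith) (by linarith)
  obtain ⟨K₂, hK₂, hE₂⟩ := exists_norm_mittagLeffler_neg_le (β := 2) (θ := 1 - α⁻¹ / 2)
    hα1.le hα2 two_pos (by linarith) (by linarith) (by linarith)
  refine ⟨2 * (K₁ ^ 2 + K₂ ^ 2), by positivity, fun t ht => ?_⟩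
  have ht0 : 0 < t := ht.1
  set C := 2 * (K₁ ^ 2 + K₂ ^ 2) with hC
  rw [← tsum_mul_left, ← tsum_mul_left, ← (ha.mul_left _).tsum_add (hb.mul_left _)]
  have hsum := (ha.mul_left (C * t ^ (1 - α))).add (hb.mul_left (C * t ^ (3 - 2 * α)))
  have hterm : ∀ n, (lam n) ^ (-1 / α) * (lam n) ^ 2 *
      ‖((a n : ℝ) : ℂ) * mittagLeffler α 1 ((-(lam n * t ^ α) : ℝ) : ℂ)
        + ((b n * t : ℝ) : ℂ) * mittagLeffler α 2 ((-(lam n * t ^ α) : ℝ) : ℂ)‖ ^ 2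
      ≤ C * t ^ (1 - α) * (lam n * (a n) ^ 2) + C * t ^ (3 - 2 * α) * (b n) ^ 2 := by
    intro n
    have hl : 0 < lam n := hlam n
    have hx : 0 < lam n * t ^ α := by positivity
    have e₁ := hE₁ _ hx
    have e₂ := hE₂ _ hx
    generalize mittagLeffler α 1 ((-(lam n * t ^ α) : ℝ) : ℂ) = E₁ at *
    generalize mittagLeffler α 2 ((-(lam n * t ^ α) : ℝ) : ℂ) = E₂ at *
    have hsq : ∀ (K θ : ℝ) (E : ℂ), ‖E‖ ≤ K * (lam n * t ^ α) ^ (-θ) →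
        ‖E‖ ^ 2 ≤ K ^ 2 * (lam n ^ (-(2 * θ)) * t ^ (-(2 * (α * θ)))) := by
      intro K θ E hE
      refine (pow_le_pow_left₀ (norm_nonneg _) hE 2).trans_eq ?_
      rw [mul_pow, ← Real.rpow_mul_natCast hx.le, Real.mul_rpow hl.le (by positivity),
        ← Real.rpow_mul ht0.le]
      congr 3 <;> (push_cast; ring)
    have s₁ := hsq _ _ _ e₁
    have s₂ := hsq _ _ _ e₂
    have hnorm : ‖((a n : ℝ) : ℂ) * E₁ + ((b n * t : ℝ) : ℂ) * E₂‖ ^ 2 ≤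
        2 * ((a n) ^ 2 * ‖E₁‖ ^ 2 + (b n) ^ 2 * t ^ 2 * ‖E₂‖ ^ 2) := by
      calc _ ≤ (‖((a n : ℝ) : ℂ) * E₁‖ + ‖((b n * t : ℝ) : ℂ) * E₂‖) ^ 2 := by
            gcongr
            exact norm_add_le _ _
        _ ≤ 2 * (‖((a n : ℝ) : ℂ) * E₁‖ ^ 2 + ‖((b n * t : ℝ) : ℂ) * E₂‖ ^ 2) := add_sq_le
        _ = _ := by
            rw [norm_mul, norm_mul, Complex.norm_real, Complex.norm_real, mul_pow, mul_pow,
              Real.norm_eq_abs, Real.norm_eq_abs, sq_abs, sq_abs, mul_pow]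
    have w₁ : lam n ^ (-1 / α) * lam n ^ 2 *
        (lam n ^ (-(2 * ((1 - α⁻¹) / 2))) * t ^ (-(2 * (α * ((1 - α⁻¹) / 2))))) =
        lam n * t ^ (1 - α) := by
      have : lam n ^ (-1 / α) * lam n ^ 2 * lam n ^ (-(2 * ((1 - α⁻¹) / 2))) = lam n := by
        rw [← Real.rpow_natCast, ← Real.rpow_add hl, ← Real.rpow_add hl]
        conv_rhs => rw [← Real.rpow_one (lam n)]
        congr 1
        push_cast; ring
      rw [← mul_assoc, this]
      congr 2
      linear_combination hinv
    have w₂ : lam n ^ (-1 / α) * lam n ^ 2 *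
        (t ^ 2 * (lam n ^ (-(2 * (1 - α⁻¹ / 2))) * t ^ (-(2 * (α * (1 - α⁻¹ / 2)))))) =
        t ^ (3 - 2 * α) := by
      have h1 : lam n ^ (-1 / α) * lam n ^ 2 * lam n ^ (-(2 * (1 - α⁻¹ / 2))) = 1 := by
        rw [← Real.rpow_natCast, ← Real.rpow_add hl, ← Real.rpow_add hl]
        conv_rhs => rw [← Real.rpow_zero (lam n)]
        congr 1
        push_cast; ring
      have h2 : t ^ 2 * t ^ (-(2 * (α * (1 - α⁻¹ / 2)))) = t ^ (3 - 2 * α) := by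
        rw [← Real.rpow_natCast, ← Real.rpow_add ht0]
        congr 1
        push_cast
        linear_combination hinv
      rw [← h2]
      linear_combination (t ^ 2 * t ^ (-(2 * (α * (1 - α⁻¹ / 2))))) * h1
    have hW : 0 ≤ lam n ^ (-1 / α) * lam n ^ 2 := by positivity
    refine (mul_le_mul_of_nonneg_left hnorm hW).trans ?_
    calc _ ≤ lam n ^ (-1 / α) * lam n ^ 2 * (2 * ((a n) ^ 2 * (K₁ ^ 2 *
          (lam n ^ (-(2 * ((1 - α⁻¹) / 2))) * t ^ (-(2 * (α * ((1 - α⁻¹) / 2)))))) +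
          (b n) ^ 2 * t ^ 2 * (K₂ ^ 2 *
          (lam n ^ (-(2 * (1 - α⁻¹ / 2))) * t ^ (-(2 * (α * (1 - α⁻¹ / 2)))))))) := by gcongr
      _ = 2 * K₁ ^ 2 * t ^ (1 - α) * (lam n * (a n) ^ 2) +
          2 * K₂ ^ 2 * t ^ (3 - 2 * α) * (b n) ^ 2 := by
          linear_combination 2 * (a n) ^ 2 * K₁ ^ 2 * w₁ + 2 * (b n) ^ 2 * K₂ ^ 2 * w₂
      _ ≤ _ := by
          gcongr
          · rw [hC]; nlinarith [sq_nonneg K₂]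
          · rw [hC]; nlinarith [sq_nonneg K₁]
  refine Summable.tsum_le_tsum hterm (Summable.of_nonneg_of_le (fun n => ?_) hterm hsum) hsum
  have := hlam n
  positivity
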